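/- In a von Neumann regular ring R, any right multiple of a right repeater is a right repeater: if x ∈ R is a right repeater and y ∈ R is arbitrary, then xy is a right repeater. Consequently, for any a, b, c ∈ R and any inner inverse a' of a, the element (1−aa')bac(1−a'a) is both a left and right repeater. -/

import Mathlib

/-- `M` is isomorphic to a direct summand of `N` (as `S`-modules). -/
def IsoToSummand (S : Type*) [Ring S] (M N : Type*) [AddCommGroup M] [AddCommGroup N]
    [Module S M] [Module S N] : Prop :=
  ∃ P Q : Submodule S N, IsCompl P Q ∧ Nonempty (M ≃ₗ[S] P)

/-- `x` is a right repeater: `x` is regular and the right ideal `xR` is isomorphic to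
a direct summand of a complement of `xR` in `R_R`.  Right ideals are
`Rᵐᵒᵖ`-submodules of `R`; `xR = Submodule.span Rᵐᵒᵖ {x}`. -/
def RightRepeater {R : Type*} [Ring R] (x : R) : Prop :=
  (∃ x' : R, x * x' * x = x) ∧
  ∃ Y : Submodule Rᵐᵒᵖ R, IsCompl (Submodule.span Rᵐᵒᵖ {x}) Y ∧
    IsoToSummand Rᵐᵒᵖ (Submodule.span Rᵐᵒᵖ {x}) Y

/-- `x` is a left repeater: `x` is regular and the left ideal `Rx` is isomorphic to
a direct summand of a complement of `Rx` in `_RR`. -/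
def LeftRepeater {R : Type*} [Ring R] (x : R) : Prop :=
  (∃ x' : R, x * x' * x = x) ∧
  ∃ Y : Submodule R R, IsCompl (Submodule.span R {x}) Y ∧
    IsoToSummand R (Submodule.span R {x}) Y

/-- Map form of the repeater condition. -/
def RepMaps {S M : Type*} [Ring S] [AddCommGroup M] [Module S M] (N : Submodule S M) : Prop :=
  ∃ e f g : M →ₗ[S] M, (∀ m, e m ∈ N) ∧ (∀ n ∈ N, e n = n) ∧ (∀ n ∈ N, e (f n) = 0) ∧
    (∀ n ∈ N, g (f n) = n)

theorem RepMaps.toIso {S M : Type*} [Ring S] [AddCommGroup M] [Module S M] {N : Submodule S M}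
    (h : RepMaps N) : ∃ Y : Submodule S M, IsCompl N Y ∧ IsoToSummand S N Y := by
  obtain ⟨e, f, g, h1, h2, h3, h4⟩ := h
  refine ⟨LinearMap.ker e, ?_, ?_⟩
  · refine IsCompl.of_eq ?_ ?_
    · rw [Submodule.eq_bot_iff]
      rintro x ⟨hx, hx'⟩
      rw [← h2 x hx]
      exact hx'
    · rw [Submodule.eq_top_iff']
      intro x
      refine Submodule.mem_sup.2 ⟨e x, h1 x, x - e x, ?_, by abel⟩
      rw [LinearMap.mem_ker, map_sub, h2 _ (h1 x), sub_self]
  · let φ : N →ₗ[S] LinearMap.ker e :=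
      (f.comp N.subtype).codRestrict _ (fun n => h3 n n.2)
    have hφ : ∀ n, ((φ n : LinearMap.ker e) : M) = f n := fun n => rfl
    have hinj : Function.Injective φ := by
      intro a b hab
      have : f a = f b := by rw [← hφ, ← hφ, hab]
      apply Subtype.ext
      rw [← h4 a a.2, ← h4 b b.2, this]
    refine ⟨LinearMap.range φ, LinearMap.ker ((e.comp g).comp (LinearMap.ker e).subtype), ?_,
      ⟨LinearEquiv.ofInjective φ hinj⟩⟩
    refine IsCompl.of_eq ?_ ?_
    · rw [Submodule.eq_bot_iff]
      rintro x ⟨⟨n, rfl⟩, hx'⟩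
      have hx2 : e (g (f n)) = 0 := hx'
      rw [h4 n n.2, h2 n n.2] at hx2
      have : n = 0 := Subtype.ext hx2
      rw [this, map_zero]
    · rw [Submodule.eq_top_iff']
      intro x
      refine Submodule.mem_sup.2 ⟨φ ⟨e (g x), h1 _⟩, ⟨_, rfl⟩, x - φ ⟨e (g x), h1 _⟩, ?_, by abel⟩
      change e (g ((x : M) - f (e (g x)))) = 0
      rw [map_sub, map_sub, h4 _ (h1 _), h2 _ (h1 _), sub_self]

theorem RepMaps.ofIso {S M : Type*} [Ring S] [AddCommGroup M] [Module S M] {N : Submodule S M}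
    (h : ∃ Y : Submodule S M, IsCompl N Y ∧ IsoToSummand S N Y) : RepMaps N := by
  obtain ⟨Y, hY, P, Q, hPQ, ⟨φ⟩⟩ := h
  refine ⟨N.subtype.comp (Submodule.projectionOnto N Y hY),
    Y.subtype.comp (P.subtype.comp (φ.toLinearMap.comp (Submodule.projectionOnto N Y hY))),
    N.subtype.comp (φ.symm.toLinearMap.comp ((Submodule.projectionOnto P Q hPQ).comp
      (Submodule.projectionOnto Y N hY.symm))), ?_, ?_, ?_, ?_⟩
  · intro m; simp
  · intro n hn
    have := Submodule.projectionOnto_apply_left hY ⟨n, hn⟩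
    simp_all
  · intro n hn
    simp
  · intro n hn
    have := Submodule.projectionOnto_apply_left hY ⟨n, hn⟩
    simp_all

theorem RepMaps.mono {S M : Type*} [Ring S] [AddCommGroup M] [Module S M] {N N' : Submodule S M}
    (h : RepMaps N) (hle : N' ≤ N) (p : M →ₗ[S] M) (hp : ∀ m, p m ∈ N')
    (hp' : ∀ n ∈ N', p n = n) : RepMaps N' := by
  obtain ⟨e, f, g, h1, h2, h3, h4⟩ := h
  refine ⟨p.comp e, f, g, fun m => hp _, fun n hn => ?_, fun n hn => ?_, fun n hn => h4 n (hle hn)⟩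
  · rw [LinearMap.comp_apply, h2 n (hle hn), hp' n hn]
  · rw [LinearMap.comp_apply, h3 n (hle hn), map_zero]

/-- Left multiplication as a map of right modules. -/
def lmulOp {R : Type*} [Ring R] (a : R) : R →ₗ[Rᵐᵒᵖ] R where
  toFun r := a * r
  map_add' := mul_add a
  map_smul' s r := by simp [mul_assoc]

/-- Right multiplication as a map of left modules. -/
def rmulOp {R : Type*} [Ring R] (a : R) : R →ₗ[R] R where
  toFun r := r * a
  map_add' r s := add_mul r s a
  map_smul' s r := by simp [mul_assoc]

theorem mem_spanR {R : Type*} [Ring R] {x n : R} :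
    n ∈ Submodule.span Rᵐᵒᵖ {x} ↔ ∃ r, x * r = n := by
  rw [Submodule.mem_span_singleton]
  exact ⟨fun ⟨a, h⟩ => ⟨a.unop, h⟩, fun ⟨a, h⟩ => ⟨MulOpposite.op a, h⟩⟩

theorem mem_spanL {R : Type*} [Ring R] {x n : R} :
    n ∈ Submodule.span R {x} ↔ ∃ r, r * x = n := by
  rw [Submodule.mem_span_singleton]
  rfl

theorem repR_mul {R : Type*} [Ring R] (hreg : ∀ a : R, ∃ b : R, a * b * a = a) (x y : R)
    (h : RepMaps (Submodule.span Rᵐᵒᵖ {x})) : RepMaps (Submodule.span Rᵐᵒᵖ {x * y}) := by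
  obtain ⟨v, hv⟩ := hreg (x * y)
  refine h.mono ?_ (lmulOp (x * y * v)) ?_ ?_
  · intro n hn
    obtain ⟨r, rfl⟩ := mem_spanR.1 hn
    exact mem_spanR.2 ⟨y * r, by rw [mul_assoc]⟩
  · intro m
    exact mem_spanR.2 ⟨v * m, (mul_assoc _ _ _).symm⟩
  · intro n hn
    obtain ⟨r, rfl⟩ := mem_spanR.1 hn
    change x * y * v * (x * y * r) = _
    rw [← mul_assoc, hv]

theorem repL_mul {R : Type*} [Ring R] (hreg : ∀ a : R, ∃ b : R, a * b * a = a) (x y : R)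
    (h : RepMaps (Submodule.span R {x})) : RepMaps (Submodule.span R {y * x}) := by
  obtain ⟨v, hv⟩ := hreg (y * x)
  refine h.mono ?_ (rmulOp (v * (y * x))) ?_ ?_
  · intro n hn
    obtain ⟨r, rfl⟩ := mem_spanL.1 hn
    exact mem_spanL.2 ⟨r * y, by rw [mul_assoc]⟩
  · intro m
    exact mem_spanL.2 ⟨m * v, (mul_assoc _ _ _)⟩
  · intro n hn
    obtain ⟨r, rfl⟩ := mem_spanL.1 hn
    change r * (y * x) * (v * (y * x)) = _
    rw [mul_assoc r, ← mul_assoc (y * x), hv]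

theorem repR_base {R : Type*} [Ring R] (hreg : ∀ a : R, ∃ b : R, a * b * a = a) (a a' b : R)
    (h : a * a' * a = a) : RepMaps (Submodule.span Rᵐᵒᵖ {(1 - a * a') * b * a}) := by
  obtain ⟨v, hv⟩ := hreg ((1 - a * a') * b * a)
  have hz : (1 - a * a') * a = 0 := by rw [sub_mul, h, one_mul, sub_self]
  have hi : (1 - a * a') * (1 - a * a') = 1 - a * a' := by
    rw [mul_sub, ← mul_assoc, hz, zero_mul, mul_one, sub_zero]
  generalize 1 - a * a' = k at *
  refine ⟨lmulOp (k * b * a * v * k), lmulOp (a * v), lmulOp (k * b), ?_, ?_, ?_, ?_⟩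
  · intro m
    exact mem_spanR.2 ⟨v * k * m, by simp [lmulOp, mul_assoc]⟩
  all_goals
    intro n hn
    obtain ⟨r, rfl⟩ := mem_spanR.1 hn
  · change k * b * a * v * k * (k * b * a * r) = k * b * a * r
    calc _ = k * b * a * v * ((k * k) * b * a) * r := by simp only [mul_assoc]
      _ = _ := by rw [hi, hv]
  · change k * b * a * v * k * (a * v * (k * b * a * r)) = 0
    calc _ = k * b * a * v * (k * a) * (v * (k * b * a * r)) := by simp only [mul_assoc]
      _ = _ := by rw [hz, mul_zero, zero_mul]
  · change k * b * (a * v * (k * b * a * r)) = k * b * a * r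
    calc _ = k * b * a * v * (k * b * a) * r := by simp only [mul_assoc]
      _ = _ := by rw [hv]

theorem repL_base {R : Type*} [Ring R] (hreg : ∀ a : R, ∃ b : R, a * b * a = a) (a a' c : R)
    (h : a * a' * a = a) : RepMaps (Submodule.span R {a * c * (1 - a' * a)}) := by
  obtain ⟨v, hv⟩ := hreg (a * c * (1 - a' * a))
  have hz : a * (1 - a' * a) = 0 := by rw [mul_sub, ← mul_assoc, h, mul_one, sub_self]
  have hi : (1 - a' * a) * (1 - a' * a) = 1 - a' * a := by
    rw [sub_mul, mul_assoc, hz, mul_zero, one_mul, sub_zero]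
  generalize 1 - a' * a = k at *
  refine ⟨rmulOp (k * v * (a * c * k)), rmulOp (v * a), rmulOp (c * k), ?_, ?_, ?_, ?_⟩
  · intro m
    exact mem_spanL.2 ⟨m * (k * v), by simp [rmulOp, mul_assoc]⟩
  all_goals
    intro n hn
    obtain ⟨r, rfl⟩ := mem_spanL.1 hn
  · change r * (a * c * k) * (k * v * (a * c * k)) = r * (a * c * k)
    calc _ = r * ((a * c * (k * k)) * v * (a * c * k)) := by simp only [mul_assoc]
      _ = _ := by rw [hi, hv]
  · change r * (a * c * k) * (v * a) * (k * v * (a * c * k)) = 0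
    calc _ = r * (a * c * k) * v * (a * k) * (v * (a * c * k)) := by simp only [mul_assoc]
      _ = _ := by rw [hz, mul_zero, zero_mul]
  · change r * (a * c * k) * (v * a) * (c * k) = r * (a * c * k)
    calc _ = r * (a * c * k * v * (a * c * k)) := by simp only [mul_assoc]
      _ = _ := by rw [hv]

theorem rightRepeater_mul_right {R : Type*} [Ring R]
    (hreg : ∀ a : R, ∃ b : R, a * b * a = a) :
    (∀ x y : R, RightRepeater x → RightRepeater (x * y)) ∧
    (∀ a a' b c : R, a * a' * a = a →
      LeftRepeater ((1 - a * a') * b * a * c * (1 - a' * a)) ∧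
      RightRepeater ((1 - a * a') * b * a * c * (1 - a' * a))) := by

  refine ⟨fun x y hx => ⟨hreg _, (repR_mul hreg x y (RepMaps.ofIso hx.2)).toIso⟩,
    fun a a' b c h => ⟨⟨hreg _, RepMaps.toIso ?_⟩, ⟨hreg _, RepMaps.toIso ?_⟩⟩⟩
  · have := repL_mul hreg _ ((1 - a * a') * b) (repL_base hreg a a' c h)
    simpa only [mul_assoc] using this
  · have := repR_mul hreg _ (c * (1 - a' * a)) (repR_base hreg a a' b h)
    simpa only [mul_assoc] using this
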